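/- Let C be a Pauli-Square-Root Clifford (PSC) and P a Pauli operator, both acting on a t-qubit register. Then, on one control qubit plus the register, C(C)·(I⊗P) = C(Q)·(I⊗P)·C(C), where Q = C P C† P† is a t-qubit Pauli operator that either commutes or anticommutes with C, and whose support is contained in the support of C. -/

import Mathlib

open Matrix Complex

noncomputable section

/-- An `n`-qubit operator: a matrix indexed by binary strings of length `n`. -/
abbrev QOp (n : ℕ) := Matrix (Fin n → Fin 2) (Fin n → Fin 2) ℂ

/-- The single-qubit Pauli `X` matrix. -/
def PauliX : Matrix (Fin 2) (Fin 2) ℂ := !![0, 1; 1, 0]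

/-- The single-qubit Pauli `Y` matrix. -/
def PauliY : Matrix (Fin 2) (Fin 2) ℂ := !![0, -Complex.I; Complex.I, 0]

/-- The single-qubit Pauli `Z` matrix. -/
def PauliZ : Matrix (Fin 2) (Fin 2) ℂ := !![1, 0; 0, -1]

/-- The tensor product of single-qubit operators, one per qubit. -/
def tensorOp {n : ℕ} (σ : Fin n → Matrix (Fin 2) (Fin 2) ℂ) : QOp n :=
  fun x y => ∏ i, σ i (x i) (y i)

/-- A matrix is unitary. -/
def IsUnitary {m : Type*} [Fintype m] [DecidableEq m] (U : Matrix m m ℂ) : Prop :=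
  U * Uᴴ = 1 ∧ Uᴴ * U = 1

/-- Membership in the `n`-qubit Pauli group: a phase in `{1, -1, i, -i}` times a
tensor product of single-qubit Pauli matrices (including the identity). -/
def IsPauli {n : ℕ} (P : QOp n) : Prop :=
  ∃ (γ : ℂ) (σ : Fin n → Matrix (Fin 2) (Fin 2) ℂ),
    (γ = 1 ∨ γ = -1 ∨ γ = Complex.I ∨ γ = -Complex.I) ∧
    (∀ i, σ i = 1 ∨ σ i = PauliX ∨ σ i = PauliY ∨ σ i = PauliZ) ∧
    P = γ • tensorOp σ

/-- An `n`-qubit Clifford unitary: conjugation preserves the Pauli group. -/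
def IsClifford {n : ℕ} (U : QOp n) : Prop :=
  IsUnitary U ∧ ∀ P : QOp n, IsPauli P → IsPauli (U * P * Uᴴ)

/-- The Clifford hierarchy: level 1 is the Pauli group; for `k ≥ 2`, level `k`
consists of the unitaries conjugating every Pauli into level `k - 1`. -/
def CliffordLevel {n : ℕ} : ℕ → QOp n → Prop
  | 0, _ => False
  | 1, V => IsPauli V
  | (k+2), V => IsUnitary V ∧ ∀ P : QOp n, IsPauli P → CliffordLevel (k+1) (V * P * Vᴴ)

/-- The controlled gate `C(U) = |0⟩⟨0| ⊗ I + |1⟩⟨1| ⊗ U`, with the control on qubit `0`. -/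
def controlled {n : ℕ} (U : QOp n) : QOp (n+1) :=
  fun x y =>
    if x 0 = y 0 then
      (if x 0 = 0 then (if Fin.tail x = Fin.tail y then 1 else 0)
       else U (Fin.tail x) (Fin.tail y))
    else 0

/-- The tensor product `a ⊗ A` of a single-qubit operator `a` (on the control qubit `0`)
with an `n`-qubit operator `A` (on the register). -/
def tensorWith {n : ℕ} (a : Matrix (Fin 2) (Fin 2) ℂ) (A : QOp n) : QOp (n+1) :=
  fun x y => a (x 0) (y 0) * A (Fin.tail x) (Fin.tail y)

/-- `A` acts trivially on qubit `i`: it is block-diagonal in the qubit-`i` basis and its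
entries do not depend on the (common) value of the `i`-th coordinate. -/
def actsTriviallyOn {n : ℕ} (A : QOp n) (i : Fin n) : Prop :=
  (∀ x y, x i ≠ y i → A x y = 0) ∧
  (∀ x y (c c' : Fin 2),
    A (Function.update x i c) (Function.update y i c) =
      A (Function.update x i c') (Function.update y i c'))

/-- The support of an operator: the set of qubits on which it acts nontrivially. -/
def Supp {n : ℕ} (A : QOp n) : Set (Fin n) := {i | ¬ actsTriviallyOn A i}

/-- A Pauli-Square-Root Clifford: a non-Pauli Clifford whose square is a Pauli. -/
def IsPSC {n : ℕ} (C : QOp n) : Prop := IsClifford C ∧ ¬ IsPauli C ∧ IsPauli (C * C)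

/-- Two operators either commute or anticommute. -/
def CommOrAnticomm {n : ℕ} (A B : QOp n) : Prop := A * B = B * A ∨ A * B = -(B * A)


lemma tensorOp_mul {n : ℕ} (σ τ : Fin n → Matrix (Fin 2) (Fin 2) ℂ) :
    tensorOp σ * tensorOp τ = tensorOp (fun i => σ i * τ i) := by
  ext x y
  simp only [tensorOp, Matrix.mul_apply, ← Finset.prod_mul_distrib]
  rw [Finset.prod_univ_sum, Fintype.piFinset_univ]

lemma tensorOp_smul {n : ℕ} (c : Fin n → ℂ) (σ : Fin n → Matrix (Fin 2) (Fin 2) ℂ) :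
    tensorOp (fun i => c i • σ i) = (∏ i, c i) • tensorOp σ := by
  ext x y
  simp [tensorOp, Finset.prod_mul_distrib]

lemma tensorOp_one {n : ℕ} : tensorOp (fun _ : Fin n => (1 : Matrix (Fin 2) (Fin 2) ℂ)) = 1 := by
  ext x y
  simp only [tensorOp, Matrix.one_apply, Finset.prod_ite_zero, funext_iff]
  simp

def IsP1 (s : Matrix (Fin 2) (Fin 2) ℂ) : Prop := s = 1 ∨ s = PauliX ∨ s = PauliY ∨ s = PauliZ

lemma phase_iff (γ : ℂ) :
    (γ = 1 ∨ γ = -1 ∨ γ = Complex.I ∨ γ = -Complex.I) ↔ γ ^ 4 = 1 := by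
  have hI := Complex.I_sq
  constructor
  · rintro (rfl | rfl | rfl | rfl) <;> norm_num
  · intro h
    have : (γ - 1) * ((γ + 1) * ((γ - Complex.I) * (γ + Complex.I))) = 0 := by
      linear_combination h - (γ ^ 2 - 1) * hI
    rcases mul_eq_zero.1 this with h | h
    · exact Or.inl (sub_eq_zero.1 h)
    rcases mul_eq_zero.1 h with h | h
    · exact Or.inr (Or.inl (eq_neg_of_add_eq_zero_left h))
    rcases mul_eq_zero.1 h with h | h
    · exact Or.inr (Or.inr (Or.inl (sub_eq_zero.1 h)))
    · exact Or.inr (Or.inr (Or.inr (eq_neg_of_add_eq_zero_left h)))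

lemma P1_eqs : PauliX * PauliX = 1 ∧ PauliY * PauliY = 1 ∧ PauliZ * PauliZ = 1 ∧
    PauliX * PauliY = Complex.I • PauliZ ∧ PauliY * PauliX = (-Complex.I) • PauliZ ∧
    PauliY * PauliZ = Complex.I • PauliX ∧ PauliZ * PauliY = (-Complex.I) • PauliX ∧
    PauliZ * PauliX = Complex.I • PauliY ∧ PauliX * PauliZ = (-Complex.I) • PauliY := by
  refine ⟨?_, ?_, ?_, ?_, ?_, ?_, ?_, ?_, ?_⟩ <;> ext i j <;> fin_cases i <;> fin_cases j <;>
    simp [PauliX, PauliY, PauliZ]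

lemma P1_mul {a b : Matrix (Fin 2) (Fin 2) ℂ} (ha : IsP1 a) (hb : IsP1 b) :
    ∃ (c : ℂ) (r : Matrix (Fin 2) (Fin 2) ℂ), c ^ 4 = 1 ∧ IsP1 r ∧ a * b = c • r := by
  obtain ⟨h1, h2, h3, h4, h5, h6, h7, h8, h9⟩ := P1_eqs
  have hI : Complex.I ^ 4 = 1 := Complex.I_pow_four
  have hI' : (-Complex.I) ^ 4 = 1 := by rw [Even.neg_pow (by decide), hI]
  have hx : IsP1 PauliX := by simp [IsP1]
  have hy : IsP1 PauliY := by simp [IsP1]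
  have hz : IsP1 PauliZ := by simp [IsP1]
  have h0 : IsP1 1 := by simp [IsP1]
  rcases ha with rfl | rfl | rfl | rfl
  · exact ⟨1, b, by simp, hb, by simp⟩
  all_goals rcases hb with rfl | rfl | rfl | rfl
  · exact ⟨1, _, by simp, hx, by simp⟩
  · exact ⟨1, _, by simp, h0, by simpa using h1⟩
  · exact ⟨_, _, hI, hz, h4⟩
  · exact ⟨_, _, hI', hy, h9⟩
  · exact ⟨1, _, by simp, hy, by simp⟩
  · exact ⟨_, _, hI', hz, h5⟩
  · exact ⟨1, _, by simp, h0, by simpa using h2⟩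
  · exact ⟨_, _, hI, hx, h6⟩
  · exact ⟨1, _, by simp, hz, by simp⟩
  · exact ⟨_, _, hI, hy, h8⟩
  · exact ⟨_, _, hI', hx, h7⟩
  · exact ⟨1, _, by simp, h0, by simpa using h3⟩

lemma P1_comm {a b : Matrix (Fin 2) (Fin 2) ℂ} (ha : IsP1 a) (hb : IsP1 b) :
    ∃ c : ℂ, c ^ 2 = 1 ∧ a * b = c • (b * a) := by
  obtain ⟨h1, h2, h3, h4, h5, h6, h7, h8, h9⟩ := P1_eqs
  rcases ha with rfl | rfl | rfl | rfl <;> rcases hb with rfl | rfl | rfl | rfl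
  all_goals first
  | (refine ⟨1, by simp, ?_⟩; simp; done)
  | exact ⟨-1, by simp, by simp [h4, h5, h6, h7, h8, h9]⟩

lemma P1_herm {a : Matrix (Fin 2) (Fin 2) ℂ} (ha : IsP1 a) : aᴴ = a := by
  rcases ha with rfl | rfl | rfl | rfl
  · simp
  all_goals ext i j; fin_cases i <;> fin_cases j <;> simp [PauliX, PauliY, PauliZ]

lemma P1_sq {a : Matrix (Fin 2) (Fin 2) ℂ} (ha : IsP1 a) : a * a = 1 := by
  obtain ⟨h1, h2, h3, -⟩ := P1_eqs
  rcases ha with rfl | rfl | rfl | rfl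
  · simp
  all_goals assumption

lemma isPauli_iff {n : ℕ} (P : QOp n) : IsPauli P ↔
    ∃ (γ : ℂ) (σ : Fin n → Matrix (Fin 2) (Fin 2) ℂ),
      γ ^ 4 = 1 ∧ (∀ i, IsP1 (σ i)) ∧ P = γ • tensorOp σ := by
  simp only [IsPauli, phase_iff, IsP1]

lemma IsPauli.mul {n : ℕ} {A B : QOp n} (hA : IsPauli A) (hB : IsPauli B) :
    IsPauli (A * B) := by
  rw [isPauli_iff] at *
  obtain ⟨γ, σ, hγ, hσ, rfl⟩ := hA
  obtain ⟨δ, τ, hδ, hτ, rfl⟩ := hB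
  choose c r hc hr h using fun i => P1_mul (hσ i) (hτ i)
  refine ⟨γ * δ * ∏ i, c i, r, ?_, hr, ?_⟩
  · rw [mul_pow, mul_pow, hγ, hδ, ← Finset.prod_pow]; simp [hc]
  · rw [Matrix.smul_mul, Matrix.mul_smul, tensorOp_mul, funext h, tensorOp_smul, smul_smul,
      smul_smul, mul_assoc]

lemma IsPauli.comm {n : ℕ} {A B : QOp n} (hA : IsPauli A) (hB : IsPauli B) :
    ∃ c : ℂ, c ^ 2 = 1 ∧ A * B = c • (B * A) := by
  rw [isPauli_iff] at *
  obtain ⟨γ, σ, hγ, hσ, rfl⟩ := hA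
  obtain ⟨δ, τ, hδ, hτ, rfl⟩ := hB
  choose c hc h using fun i => P1_comm (hσ i) (hτ i)
  refine ⟨∏ i, c i, ?_, ?_⟩
  · rw [← Finset.prod_pow]; simp [hc]
  · rw [Matrix.smul_mul, Matrix.mul_smul, tensorOp_mul, funext h, tensorOp_smul,
      Matrix.smul_mul, Matrix.mul_smul, tensorOp_mul]
    simp only [smul_smul]
    congr 1; ring

lemma tensorOp_herm {n : ℕ} {σ : Fin n → Matrix (Fin 2) (Fin 2) ℂ} (h : ∀ i, IsP1 (σ i)) :
    (tensorOp σ)ᴴ = tensorOp σ := by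
  ext x y
  simp only [tensorOp, Matrix.conjTranspose_apply, star_prod]
  refine Finset.prod_congr rfl fun i _ => ?_
  rw [← Matrix.conjTranspose_apply, P1_herm (h i)]

lemma IsPauli.herm {n : ℕ} {A : QOp n} (hA : IsPauli A) :
    ∃ c : ℂ, c ^ 2 = 1 ∧ Aᴴ = c • A := by
  obtain ⟨γ, σ, hγ, hσ, rfl⟩ := hA
  rw [Matrix.conjTranspose_smul, tensorOp_herm hσ]
  rcases hγ with rfl | rfl | rfl | rfl
  · exact ⟨1, by simp, by simp⟩
  · exact ⟨1, by simp, by simp⟩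
  · exact ⟨-1, by simp, by simp⟩
  · exact ⟨-1, by simp, by simp⟩

lemma IsPauli.smul {n : ℕ} {A : QOp n} (hA : IsPauli A) {c : ℂ} (hc : c ^ 2 = 1) :
    IsPauli (c • A) := by
  rw [isPauli_iff] at *
  obtain ⟨γ, σ, hγ, hσ, rfl⟩ := hA
  exact ⟨c * γ, σ, by linear_combination c ^ 4 * hγ + (c ^ 2 + 1) * hc, hσ, by rw [smul_smul]⟩

lemma IsPauli.conj {n : ℕ} {A : QOp n} (hA : IsPauli A) : IsPauli Aᴴ := by
  obtain ⟨c, hc, h⟩ := hA.herm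
  rw [h]; exact hA.smul hc

lemma IsPauli.unitary {n : ℕ} {A : QOp n} (hA : IsPauli A) : Aᴴ * A = 1 := by
  obtain ⟨γ, σ, hγ, hσ, rfl⟩ := hA
  have h : tensorOp σ * tensorOp σ = 1 := by
    rw [tensorOp_mul, ← tensorOp_one]; congr 1; funext i; exact P1_sq (hσ i)
  rw [Matrix.conjTranspose_smul, tensorOp_herm hσ, Matrix.smul_mul, Matrix.mul_smul, h, smul_smul]
  rcases hγ with rfl | rfl | rfl | rfl <;> simp

def at1 {n : ℕ} (i : Fin n) (a : Matrix (Fin 2) (Fin 2) ℂ) : QOp n :=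
  tensorOp (Function.update (fun _ => 1) i a)

lemma at1_pauli {n : ℕ} (i : Fin n) {a : Matrix (Fin 2) (Fin 2) ℂ} (ha : IsP1 a) :
    IsPauli (at1 i a) := by
  rw [isPauli_iff]
  refine ⟨1, _, by simp, fun j => ?_, (one_smul _ _).symm⟩
  by_cases h : j = i
  · subst h; simpa using ha
  · simp [h, IsP1]

lemma at1_apply {n : ℕ} (i : Fin n) (a : Matrix (Fin 2) (Fin 2) ℂ) (x y : Fin n → Fin 2) :
    at1 i a x y = if (∀ j, j ≠ i → x j = y j) then a (x i) (y i) else 0 := by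
  unfold at1 tensorOp
  split_ifs with h
  · rw [Finset.prod_eq_single i]
    · simp
    · intro j _ hj
      simp [hj, h j hj]
    · simp
  · push Not at h
    obtain ⟨j, hj, hxy⟩ := h
    exact Finset.prod_eq_zero (Finset.mem_univ j) (by simp [hj, hxy])

lemma at1Z {n : ℕ} (i : Fin n) :
    at1 i PauliZ = Matrix.diagonal (fun x => if x i = 0 then (1 : ℂ) else -1) := by
  ext x y
  rw [at1_apply, Matrix.diagonal_apply]
  by_cases h : x = y
  · subst h
    simp only [implies_true, if_true]
    generalize x i = u
    fin_cases u <;> simp [PauliZ]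
  · rw [if_neg h]
    split_ifs with h'
    · have : x i ≠ y i := fun e => h (funext fun j => by
        by_cases hj : j = i
        · rw [hj, e]
        · exact h' j hj)
      revert this
      generalize x i = u; generalize y i = v
      fin_cases u <;> fin_cases v <;> simp [PauliZ]
    · rfl

def fl {n : ℕ} (i : Fin n) (x : Fin n → Fin 2) : Fin n → Fin 2 :=
  Function.update x i (x i + 1)

lemma fin2_aa (u : Fin 2) : u + 1 + 1 = u := by fin_cases u <;> rfl

lemma fl_fl {n : ℕ} (i : Fin n) (x : Fin n → Fin 2) : fl i (fl i x) = x := by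
  simp [fl, fin2_aa]

lemma at1X {n : ℕ} (i : Fin n) (x y : Fin n → Fin 2) :
    at1 i PauliX x y = if y = fl i x then 1 else 0 := by
  rw [at1_apply]
  by_cases h : y = fl i x
  · subst h
    have : ∀ j, j ≠ i → x j = fl i x j := fun j hj => by simp [fl, hj]
    rw [if_pos this, if_pos rfl]
    simp only [fl, Function.update_self]
    generalize x i = u
    fin_cases u <;> simp [PauliX]
  · rw [if_neg h]
    split_ifs with h'
    · have : y i ≠ x i + 1 := fun e => h (funext fun j => by
        by_cases hj : j = i
        · rw [hj, e]; simp [fl]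
        · rw [← h' j hj]; simp [fl, hj])
      revert this
      generalize x i = u; generalize y i = v
      fin_cases u <;> fin_cases v <;> simp [PauliX]
    · rfl

lemma commX_iff {n : ℕ} (i : Fin n) (A : QOp n) :
    A * at1 i PauliX = at1 i PauliX * A ↔ ∀ x y, A x (fl i y) = A (fl i x) y := by
  rw [← Matrix.ext_iff]
  refine forall_congr' fun x => forall_congr' fun y => ?_
  have e : ∀ z, (y = fl i z) ↔ (z = fl i y) := fun z =>
    ⟨fun h => by rw [h, fl_fl], fun h => by rw [h, fl_fl]⟩
  simp [Matrix.mul_apply, at1X, e]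

lemma commZ_iff {n : ℕ} (i : Fin n) (A : QOp n) :
    A * at1 i PauliZ = at1 i PauliZ * A ↔ ∀ x y, x i ≠ y i → A x y = 0 := by
  rw [← Matrix.ext_iff]
  refine forall_congr' fun x => forall_congr' fun y => ?_
  rw [at1Z, Matrix.mul_diagonal, Matrix.diagonal_mul]
  generalize x i = u; generalize y i = v
  fin_cases u <;> fin_cases v <;> simp [self_eq_neg, neg_eq_self, mul_comm]

lemma trivial_iff {n : ℕ} (i : Fin n) (A : QOp n) : actsTriviallyOn A i ↔
    A * at1 i PauliZ = at1 i PauliZ * A ∧ A * at1 i PauliX = at1 i PauliX * A := by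
  rw [commZ_iff, commX_iff]
  unfold actsTriviallyOn
  refine and_congr_right fun hZ => ⟨fun h x y => ?_, fun h x y c c' => ?_⟩
  · by_cases e : x i = y i + 1
    · have := h x (fl i y) (x i) (x i + 1)
      rw [Function.update_eq_self] at this
      have e2 : Function.update (fl i y) i (x i) = fl i y := by simp [fl, e]
      have e3 : Function.update (fl i y) i (x i + 1) = y := by simp [fl, e, fin2_aa]
      rw [e2, e3] at this
      exact this
    · rw [hZ _ _ (by simpa [fl] using e), hZ]
      simp only [fl, Function.update_self]
      intro e'
      exact e (by rw [← e', fin2_aa])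
  · by_cases e : c = c'
    · rw [e]
    · have e : c' = c + 1 := by
        revert e; fin_cases c <;> fin_cases c' <;> simp
      subst e
      have := h (Function.update x i c) (Function.update y i (c + 1))
      simpa [fl, fin2_aa] using this

def bd {n : ℕ} (A B : QOp n) : QOp (n+1) :=
  fun x y => if x 0 = y 0 then (if x 0 = 0 then A (Fin.tail x) (Fin.tail y)
       else B (Fin.tail x) (Fin.tail y)) else 0

lemma bd_mul {n : ℕ} (A B A' B' : QOp n) : bd A B * bd A' B' = bd (A * A') (B * B') := by
  ext x y
  rw [Matrix.mul_apply, ← (Fin.consEquiv (fun _ => Fin 2)).sum_comp, Fintype.sum_prod_type,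
    Fin.sum_univ_two]
  simp only [bd, Fin.consEquiv_apply, Fin.cons_zero, Matrix.mul_apply]
  generalize x 0 = u; generalize y 0 = v
  fin_cases u <;> fin_cases v <;> simp <;> rfl

lemma controlled_eq {n : ℕ} (U : QOp n) : controlled U = bd 1 U := by
  ext x y
  simp [controlled, bd, Matrix.one_apply]

lemma tensorWith_eq {n : ℕ} (U : QOp n) : tensorWith 1 U = bd U U := by
  ext x y
  simp [tensorWith, bd, Matrix.one_apply]

lemma supp_aux {n : ℕ} {C P : QOp n} (hC : IsUnitary C) (hP : IsPauli P) {E : QOp n}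
    (hE : IsPauli E) (h : C * E = E * C) :
    (C * P * Cᴴ * Pᴴ) * E = E * (C * P * Cᴴ * Pᴴ) := by
  have h' : Cᴴ * E = E * Cᴴ := by
    calc Cᴴ * E = Cᴴ * (E * C) * Cᴴ := by
          rw [Matrix.mul_assoc, Matrix.mul_assoc E, hC.1, Matrix.mul_one]
      _ = Cᴴ * C * E * Cᴴ := by rw [← h]; simp only [Matrix.mul_assoc]
      _ = _ := by rw [hC.2, Matrix.one_mul]
  obtain ⟨c, hc, h1⟩ := hP.conj.comm hE
  have hEE : P * E = c • (E * P) := by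
    have hu := hP.unitary
    have hu' := mul_eq_one_comm.1 hu
    have : E * P = c • (P * E) := by
      calc E * P = P * (Pᴴ * E) * P := by rw [← Matrix.mul_assoc, hu', Matrix.one_mul]
        _ = c • (P * E * (Pᴴ * P)) := by
          rw [h1, Matrix.mul_smul, Matrix.smul_mul]; simp only [Matrix.mul_assoc]
        _ = _ := by rw [hu, Matrix.mul_one]
    rw [this, smul_smul, ← sq, hc, one_smul]
  calc (C * P * Cᴴ * Pᴴ) * E = C * P * Cᴴ * (Pᴴ * E) := by simp only [Matrix.mul_assoc]
    _ = c • (C * P * (Cᴴ * E) * Pᴴ) := by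
      rw [h1, Matrix.mul_smul]; simp only [Matrix.mul_assoc]
    _ = c • (C * (P * E) * Cᴴ * Pᴴ) := by rw [h']; simp only [Matrix.mul_assoc]
    _ = (c ^ 2) • ((C * E) * P * Cᴴ * Pᴴ) := by
      rw [hEE, sq, mul_smul]; simp only [Matrix.mul_smul, Matrix.smul_mul, Matrix.mul_assoc]
    _ = _ := by rw [hc, one_smul, h]; simp only [Matrix.mul_assoc]

lemma comm_aux {n : ℕ} {C P : QOp n} (hC : IsUnitary C) (hP : IsPauli P) (hCC : IsPauli (C * C))
    (hQ : IsPauli (C * P * Cᴴ * Pᴴ)) : CommOrAnticomm (C * P * Cᴴ * Pᴴ) C := by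
  obtain ⟨c, hc, h1⟩ := hCC.comm hP
  obtain ⟨d, hd, h2⟩ := hQ.herm
  have key : C * (C * P * Cᴴ * Pᴴ) = (c * d) • ((C * P * Cᴴ * Pᴴ) * C) := by
    calc C * (C * P * Cᴴ * Pᴴ) = (C * C * P) * Cᴴ * Pᴴ := by simp only [Matrix.mul_assoc]
      _ = c • (P * C * (C * Cᴴ) * Pᴴ) := by
        rw [h1]; simp only [Matrix.smul_mul, Matrix.mul_assoc]
      _ = c • (P * C * Pᴴ * (Cᴴ * C)) := by
        rw [hC.1, hC.2]; simp only [Matrix.mul_one]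
      _ = c • ((C * P * Cᴴ * Pᴴ)ᴴ * C) := by
        simp only [Matrix.conjTranspose_mul, Matrix.conjTranspose_conjTranspose, Matrix.mul_assoc]
      _ = _ := by rw [h2, Matrix.smul_mul, smul_smul]
  have hcd : (c * d) ^ 2 = 1 := by rw [mul_pow, hc, hd, one_mul]
  rcases (by simpa using hcd : c * d = 1 ∨ c * d = -1) with h | h
  · left; rw [key, h, one_smul]
  · right; rw [key, h]; simp

/-- For a PSC `C` and a Pauli `P` on `t` qubits,
`C(C)·(I⊗P) = C(Q)·(I⊗P)·C(C)` where `Q = C P C† P†` is a Pauli that either commutes or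
anticommutes with `C` and whose support is contained in that of `C`. -/
theorem controlled_psc_prop_pauli {t : ℕ} (C P : QOp t) (hC : IsPSC C) (hP : IsPauli P) :
    IsPauli (C * P * Cᴴ * Pᴴ) ∧
    CommOrAnticomm (C * P * Cᴴ * Pᴴ) C ∧
    Supp (C * P * Cᴴ * Pᴴ) ⊆ Supp C ∧
    controlled C * tensorWith 1 P =
      controlled (C * P * Cᴴ * Pᴴ) * (tensorWith 1 P * controlled C) := by
  obtain ⟨⟨hU, hCl⟩, -, hCC⟩ := hC
  have hQ : IsPauli (C * P * Cᴴ * Pᴴ) := (hCl P hP).mul hP.conj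
  refine ⟨hQ, comm_aux hU hP hCC hQ, ?_, ?_⟩
  · intro i hi hn
    apply hi
    rw [trivial_iff] at hn ⊢
    exact ⟨supp_aux hU hP (at1_pauli i (by simp [IsP1])) hn.1,
      supp_aux hU hP (at1_pauli i (by simp [IsP1])) hn.2⟩
  · rw [controlled_eq, controlled_eq, tensorWith_eq, bd_mul, bd_mul, bd_mul]
    congr 1
    · simp
    · calc C * P = C * P * (Cᴴ * ((Pᴴ * P) * C)) := by
            rw [hP.unitary, Matrix.one_mul, hU.2, Matrix.mul_one]
        _ = _ := by simp only [Matrix.mul_assoc]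

end
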